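/- Let J ⊆ I. Every interval of the augmented interval poset Q̂^J is graded and thin: for any q1 ≤ q2 in Q̂^J, a maximal chain from q1 to q2 exists, all maximal chains from q1 to q2 have the same length, and every interval of length 2 in Q̂^J contains exactly 4 elements. -/

import Mathlib

/-!
Common definitions: Bruhat order, standard parabolic subgroups, minimal coset
representatives, the J-Bruhat (twisted) order and J-length, chains and
EL-labeling machinery, for a Coxeter system `cs : CoxeterSystem M W`.
-/

open scoped Classical

namespace TwistedTP

/-- A chain (list) realizing consecutive `r`-steps starting at `a` and ending at `b`. -/
def IsChainFrom {α : Type*} (r : α → α → Prop) (c : List α) (a b : α) : Prop :=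
  c.head? = some a ∧ c.getLast? = some b ∧ c.Chain' r

/-- The word of labels attached to the consecutive pairs of a list.
For a list `z₀ :: z₁ :: ⋯` (written from top to bottom in a descending chain),
the entries are `lab z₁ z₀, lab z₂ z₁, …`, i.e. `lab` is applied to each
covering pair `(lower, upper)`. -/
def labelWord {α Λ : Type*} (lab : α → α → Λ) : List α → List Λ
  | a :: b :: rest => lab b a :: labelWord lab (b :: rest)
  | _ => []

variable {B : Type*} {W : Type*} [Group W] {M : CoxeterMatrix B}
variable (cs : CoxeterSystem M W)

/-- The (strong) Bruhat order on `W`: `v ≤ w` iff some reduced word for `w`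
has a sublist whose product is `v`. -/
def bruhatLE (v w : W) : Prop :=
  ∃ ω : List B, cs.IsReduced ω ∧ cs.wordProd ω = w ∧
    ∃ ω' : List B, ω'.Sublist ω ∧ cs.wordProd ω' = v

def bruhatLT (v w : W) : Prop := bruhatLE cs v w ∧ v ≠ w

def bruhatCovBy (v w : W) : Prop :=
  bruhatLT cs v w ∧ ¬ ∃ z, bruhatLT cs v z ∧ bruhatLT cs z w

/-- The standard parabolic subgroup `W_J`. -/
def parabolic (J : Set B) : Subgroup W := Subgroup.closure (cs.simple '' J)

lemma exists_minRep (J : Set B) (w : W) :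
    ∃ u : W, u⁻¹ * w ∈ parabolic cs J ∧
      ∀ x : W, x⁻¹ * w ∈ parabolic cs J → cs.length u ≤ cs.length x := by
  have hne : (cs.length '' {x : W | x⁻¹ * w ∈ parabolic cs J}).Nonempty :=
    ⟨cs.length w, w, by simpa using (parabolic cs J).one_mem, rfl⟩
  obtain ⟨n, hn, hmin⟩ := Nat.lt_wfRel.wf.has_min _ hne
  obtain ⟨u, hu, rfl⟩ := hn
  refine ⟨u, hu, fun x hx => ?_⟩
  by_contra h
  exact hmin _ ⟨x, hx, rfl⟩ (Nat.lt_of_not_le h)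

/-- The minimal-length representative `w^J` of the coset `w W_J`. -/
noncomputable def minRep (J : Set B) (w : W) : W := (exists_minRep cs J w).choose

/-- The parabolic part `w_J = (w^J)⁻¹ w ∈ W_J` of `w`. -/
noncomputable def parPart (J : Set B) (w : W) : W := (minRep cs J w)⁻¹ * w

/-- The J-Bruhat (twisted) order `≤^J` on `W`:
`v ≤^J w` iff there is `u ∈ W_J` with `v^J u ≤ w^J` and `w_J ≤ u⁻¹ v_J`. -/
def twistedLE (J : Set B) (v w : W) : Prop :=
  ∃ u ∈ parabolic cs J,
    bruhatLE cs (minRep cs J v * u) (minRep cs J w) ∧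
    bruhatLE cs (parPart cs J w) (u⁻¹ * parPart cs J v)

def twistedLT (J : Set B) (v w : W) : Prop := twistedLE cs J v w ∧ v ≠ w

def twistedCovBy (J : Set B) (v w : W) : Prop :=
  twistedLT cs J v w ∧ ¬ ∃ z, twistedLT cs J v z ∧ twistedLT cs J z w

/-- The J-length `ℓ^J(w) = ℓ(w^J) - ℓ(w_J)` (an integer). -/
noncomputable def twistedLength (J : Set B) (w : W) : ℤ :=
  (cs.length (minRep cs J w) : ℤ) - (cs.length (parPart cs J w) : ℤ)



/-- Membership in the augmented interval poset `Q̂^J`: `none` is the adjoined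
minimum `0̂`, and `some (x, y)` represents the interval `[x, y]` of `(W, ≤^J)`
(so we require `x ≤^J y`). -/
def qvalid (J : Set B) : Option (W × W) → Prop
  | none => True
  | some p => twistedLE cs J p.1 p.2

/-- The order of `Q̂^J`: `[x₁,y₁] ≤ [x₂,y₂]` iff `x₂ ≤^J x₁` and `y₁ ≤^J y₂`;
the adjoined `0̂` is below everything. -/
def qle (J : Set B) : Option (W × W) → Option (W × W) → Prop
  | none, _ => True
  | some _, none => False
  | some p, some q => twistedLE cs J q.1 p.1 ∧ twistedLE cs J p.2 q.2

def qlt (J : Set B) (p q : Option (W × W)) : Prop := qle cs J p q ∧ p ≠ q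

/-- The covering relation of the poset `Q̂^J` (among its members). -/
def qcov (J : Set B) (p q : Option (W × W)) : Prop :=
  qvalid cs J p ∧ qvalid cs J q ∧ qlt cs J p q ∧
    ¬∃ z : Option (W × W), qvalid cs J z ∧ qlt cs J p z ∧ qlt cs J z q

section StrongExchange

/-- The involution `(x, ε) ↦ (s x s, ε + [x = s])` of `W × ℤ/2` attached to a simple reflection. -/
noncomputable def signedConj (i : B) : Equiv.Perm (W × ZMod 2) :=
  Function.Involutive.toPerm
    (fun p => (cs.simple i * p.1 * cs.simple i, p.2 + if p.1 = cs.simple i then 1 else 0))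
    (by
      rintro ⟨x, ε⟩
      have h : cs.simple i * x * cs.simple i = cs.simple i ↔ x = cs.simple i := by
        constructor
        · intro h
          have := congrArg (fun y => cs.simple i * y * cs.simple i) h
          simpa [mul_assoc] using this
        · rintro rfl
          simp
      ext
      · simp [mul_assoc]
      · simp only [h, add_assoc]
        split_ifs
        · simp [CharTwo.add_self_eq_zero]
        · simp)

lemma signedConj_apply (i : B) (x : W) (ε : ZMod 2) :
    signedConj cs i (x, ε) =
      (cs.simple i * x * cs.simple i, ε + if x = cs.simple i then 1 else 0) := rfl

lemma signedConj_word (ω : List B) (x : W) (ε : ZMod 2) :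
    (ω.map (signedConj cs)).prod (x, ε) =
      (cs.wordProd ω * x * (cs.wordProd ω)⁻¹, ε + ((cs.rightInvSeq ω).count x : ZMod 2)) := by
  induction ω with
  | nil => simp
  | cons i ω ih =>
    rw [List.map_cons, List.prod_cons, Equiv.Perm.mul_apply, ih, signedConj_apply]
    have h : cs.wordProd ω * x * (cs.wordProd ω)⁻¹ = cs.simple i ↔
        (cs.wordProd ω)⁻¹ * cs.simple i * cs.wordProd ω = x := by
      constructor
      · intro h
        rw [← h]
        group
      · rintro rfl
        group
    ext
    · simp [cs.wordProd_cons, mul_assoc]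
    · simp only [CoxeterSystem.rightInvSeq, List.count_cons, beq_iff_eq, h, Nat.cast_add,
        Nat.cast_ite, Nat.cast_one, Nat.cast_zero, add_assoc]

lemma even_count_of_periodic {α : Type*} (L : List α) (m : ℕ) (hL : L.length = 2 * m)
    (hp : ∀ k (hk : k < m), L[k]'(by omega) = L[k + m]'(by omega)) (x : α) :
    Even (L.count x) := by
  have h : L.take m = L.drop m := by
    apply List.ext_getElem
    · simp; omega
    · intro k h₁ h₂
      simp only [List.getElem_take, List.getElem_drop]
      rw [hp k (by simp at h₁; omega)]
      simp only [add_comm]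
  rw [← List.take_append_drop m L, List.count_append, h]
  exact ⟨_, rfl⟩

lemma even_count_leftInvSeq_alternatingWord (i j : B) (x : W) :
    Even ((cs.leftInvSeq (CoxeterSystem.alternatingWord i j (2 * M i j))).count x) := by
  refine even_count_of_periodic _ (M i j) (by simp) (fun k hk => ?_) x
  rw [cs.getElem_leftInvSeq_alternatingWord i j (M i j) k (by omega),
    cs.getElem_leftInvSeq_alternatingWord i j (M i j) (k + M i j) (by omega),
    cs.prod_alternatingWord_eq_mul_pow, cs.prod_alternatingWord_eq_mul_pow]
  have h₁ : ¬ Even (2 * k + 1) := by simp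
  have h₂ : ¬ Even (2 * (k + M i j) + 1) := by simp
  have h₃ : (2 * k + 1) / 2 = k := by omega
  have h₄ : (2 * (k + M i j) + 1) / 2 = k + M i j := by omega
  rw [if_neg h₁, if_neg h₂, h₃, h₄, pow_add, cs.simple_mul_simple_pow', mul_one]

lemma map_alternatingWord_prod {G : Type*} [Group G] (f : B → G) (i j : B) (m : ℕ) :
    ((CoxeterSystem.alternatingWord i j (2 * m)).map f).prod = (f i * f j) ^ m := by
  induction m with
  | zero => simp [CoxeterSystem.alternatingWord]
  | succ m ih =>
    rw [show 2 * (m + 1) = 2 * m + 1 + 1 by ring, CoxeterSystem.alternatingWord_succ',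
      CoxeterSystem.alternatingWord_succ', pow_succ', ← ih]
    simp [mul_assoc]

lemma reverse_alternatingWord (i j : B) (m : ℕ) :
    (CoxeterSystem.alternatingWord i j (2 * m)).reverse =
      CoxeterSystem.alternatingWord j i (2 * m) := by
  induction m with
  | zero => simp [CoxeterSystem.alternatingWord]
  | succ m ih =>
    rw [show 2 * (m + 1) = 2 * m + 1 + 1 by ring, CoxeterSystem.alternatingWord_succ',
      CoxeterSystem.alternatingWord_succ', List.reverse_cons, List.reverse_cons, ih,
      CoxeterSystem.alternatingWord_succ, CoxeterSystem.alternatingWord_succ]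
    simp

lemma signedConj_isLiftable : M.IsLiftable (signedConj cs) := by
  intro i j
  rw [← map_alternatingWord_prod]
  ext1 ⟨x, ε⟩
  rw [signedConj_word]
  have h₁ : cs.wordProd (CoxeterSystem.alternatingWord i j (2 * M i j)) = 1 := by
    rw [CoxeterSystem.wordProd, map_alternatingWord_prod, cs.simple_mul_simple_pow]
  have h₂ : Even ((cs.rightInvSeq (CoxeterSystem.alternatingWord i j (2 * M i j))).count x) := by
    rw [← reverse_alternatingWord, cs.rightInvSeq_reverse, List.count_reverse, M.symmetric i j]
    exact even_count_leftInvSeq_alternatingWord cs j i x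
  rw [h₁, (ZMod.natCast_eq_zero_iff_even).2 h₂]
  simp

/-- The action of `W` on `W × ℤ/2` extending `signedConj`. -/
noncomputable def signedConjHom : W →* Equiv.Perm (W × ZMod 2) :=
  cs.lift ⟨signedConj cs, signedConj_isLiftable cs⟩

lemma signedConjHom_wordProd (ω : List B) (x : W) (ε : ZMod 2) :
    signedConjHom cs (cs.wordProd ω) (x, ε) =
      (cs.wordProd ω * x * (cs.wordProd ω)⁻¹, ε + ((cs.rightInvSeq ω).count x : ZMod 2)) := by
  rw [← signedConj_word]
  congr 2
  rw [CoxeterSystem.wordProd, map_list_prod, List.map_map]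
  congr 2
  funext i
  exact cs.lift_apply_simple (signedConj_isLiftable cs) i

lemma signedConjHom_fst (w x : W) (ε : ZMod 2) :
    (signedConjHom cs w (x, ε)).1 = w * x * w⁻¹ := by
  obtain ⟨ω, rfl⟩ := cs.wordProd_surjective w
  rw [signedConjHom_wordProd]

lemma signedConjHom_add (w x : W) (ε δ : ZMod 2) :
    signedConjHom cs w (x, ε + δ) =
      ((signedConjHom cs w (x, ε)).1, (signedConjHom cs w (x, ε)).2 + δ) := by
  obtain ⟨ω, rfl⟩ := cs.wordProd_surjective w
  rw [signedConjHom_wordProd, signedConjHom_wordProd]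
  ext
  · rfl
  · simp only
    ring

lemma signedConjHom_reflection {t : W} (ht : cs.IsReflection t) (ε : ZMod 2) :
    signedConjHom cs t (t, ε) = (t, ε + 1) := by
  obtain ⟨u, i, rfl⟩ := ht
  have hs : ∀ ε, signedConjHom cs (cs.simple i) (cs.simple i, ε) = (cs.simple i, ε + 1) := by
    intro ε
    have := signedConjHom_wordProd cs [i] (cs.simple i) ε
    simpa using this
  rw [map_mul, map_mul, Equiv.Perm.mul_apply, Equiv.Perm.mul_apply]
  obtain ⟨δ, hδ⟩ : ∃ δ, signedConjHom cs u⁻¹ (u * cs.simple i * u⁻¹, ε) = (cs.simple i, δ) :=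
    ⟨_, Prod.ext (by rw [signedConjHom_fst]; group) rfl⟩
  rw [hδ, hs, signedConjHom_add, ← hδ, ← Equiv.Perm.mul_apply, ← map_mul]
  simp

/-- The strong exchange property, for an arbitrary word. -/
lemma mem_rightInvSeq_of_length_lt {t : W} (ht : cs.IsReflection t) (ω : List B)
    (h : cs.length (cs.wordProd ω * t) < cs.length (cs.wordProd ω)) :
    t ∈ cs.rightInvSeq ω := by
  obtain ⟨ω', hω', he⟩ := cs.exists_isReduced (cs.wordProd ω * t)
  have key : signedConjHom cs (cs.wordProd ω) (t, 0) =
      signedConjHom cs (cs.wordProd ω') (t, 1) := by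
    rw [← he, map_mul, Equiv.Perm.mul_apply, signedConjHom_reflection cs ht,
      CharTwo.add_self_eq_zero]
  rw [signedConjHom_wordProd, signedConjHom_wordProd] at key
  have hnot : t ∉ cs.rightInvSeq ω' := by
    intro hmem
    have := (cs.isRightInversion_of_mem_rightInvSeq hω' hmem).2
    rw [← he, mul_assoc, ht.mul_self, mul_one] at this
    omega
  have h₂ := congrArg Prod.snd key
  simp only [List.count_eq_zero_of_not_mem hnot] at h₂
  by_contra hmem
  simp [List.count_eq_zero_of_not_mem hmem] at h₂

lemma exists_eraseIdx_of_length_mul_lt {t : W} (ht : cs.IsReflection t) (ω : List B)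
    (h : cs.length (cs.wordProd ω * t) < cs.length (cs.wordProd ω)) :
    ∃ j < ω.length, cs.wordProd ω * t = cs.wordProd (ω.eraseIdx j) := by
  obtain ⟨j, hj, rfl⟩ := List.mem_iff_getElem.1 (mem_rightInvSeq_of_length_lt cs ht ω h)
  rw [cs.length_rightInvSeq] at hj
  refine ⟨j, hj, ?_⟩
  rw [← cs.wordProd_mul_getD_rightInvSeq, List.getD_eq_getElem]

lemma exists_eraseIdx_of_length_lt {t : W} (ht : cs.IsReflection t) (ω : List B)
    (h : cs.length (t * cs.wordProd ω) < cs.length (cs.wordProd ω)) :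
    ∃ j < ω.length, t * cs.wordProd ω = cs.wordProd (ω.eraseIdx j) := by
  have ht' := ht.conj (cs.wordProd ω)⁻¹
  have he : cs.wordProd ω * ((cs.wordProd ω)⁻¹ * t * (cs.wordProd ω)⁻¹⁻¹) = t * cs.wordProd ω := by
    group
  obtain ⟨j, hj, hw⟩ := exists_eraseIdx_of_length_mul_lt cs ht' ω (by rwa [he])
  exact ⟨j, hj, he ▸ hw⟩

end StrongExchange

section Bruhat

/-- `x` is obtained from `y` by a length-decreasing left multiplication by a reflection. -/
def reflLT (x y : W) : Prop :=
  ∃ t, cs.IsReflection t ∧ x = t * y ∧ cs.length x < cs.length y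

variable {cs}

lemma length_mul_add_one_of_lt {x y : W} (h : reflLT cs x y) :
    (cs.length x + 1) % 2 = cs.length y % 2 := by
  obtain ⟨t, ht, rfl, -⟩ := h
  have := cs.length_mul_mod_two t y
  have := Nat.odd_iff.1 ht.odd_length
  omega

lemma reflLT.simple_mul {x y : W} (h : reflLT cs x y) (i : B)
    (hl : cs.length (cs.simple i * x) < cs.length (cs.simple i * y)) :
    reflLT cs (cs.simple i * x) (cs.simple i * y) := by
  obtain ⟨t, ht, rfl, -⟩ := h
  refine ⟨cs.simple i * t * (cs.simple i)⁻¹, ht.conj _, ?_, hl⟩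
  simp [mul_assoc]

lemma reflLT_simple_mul {y : W} {i : B} (h : cs.length y < cs.length (cs.simple i * y)) :
    reflLT cs y (cs.simple i * y) :=
  ⟨cs.simple i, cs.isReflection_simple i, by simp, h⟩

lemma reflLT_of_simple_mul_lt {y : W} {i : B} (h : cs.length (cs.simple i * y) < cs.length y) :
    reflLT cs (cs.simple i * y) y :=
  ⟨cs.simple i, cs.isReflection_simple i, rfl, h⟩

/-- A reduced word starting with a given left descent. -/
lemma exists_reduced_cons {y : W} {i : B} (h : cs.length (cs.simple i * y) < cs.length y) :
    ∃ ω : List B, cs.IsReduced (i :: ω) ∧ cs.wordProd (i :: ω) = y ∧ cs.IsReduced ω ∧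
      cs.wordProd ω = cs.simple i * y := by
  obtain ⟨ω, hω, he⟩ := cs.exists_isReduced (cs.simple i * y)
  have hy : cs.wordProd (i :: ω) = y := by
    rw [cs.wordProd_cons, ← he, cs.simple_mul_simple_cancel_left]
  refine ⟨ω, ?_, hy, hω, he.symm⟩
  have h₁ := hω.eq
  rw [← he] at h₁
  rw [CoxeterSystem.IsReduced, hy, List.length_cons, ← h₁]
  have := cs.length_simple_mul y i
  omega

lemma reflLT.simple_mul_reflTransGen {x y : W} (h : reflLT cs x y) (i : B) :
    (cs.length y < cs.length (cs.simple i * y) →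
      Relation.ReflTransGen (reflLT cs) (cs.simple i * x) (cs.simple i * y)) ∧
    (cs.length (cs.simple i * y) < cs.length y →
      Relation.ReflTransGen (reflLT cs) (cs.simple i * x) y) := by
  have hxy : cs.length x < cs.length y := h.choose_spec.2.2
  have hpar := length_mul_add_one_of_lt h
  have hsx := cs.length_simple_mul x i
  have hsy := cs.length_simple_mul y i
  constructor
  · intro hy
    exact .single (h.simple_mul i (by omega))
  · intro hy
    by_cases hl : cs.length (cs.simple i * x) < cs.length (cs.simple i * y)
    · exact .tail (.single (h.simple_mul i hl)) (reflLT_of_simple_mul_lt hy)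
    · obtain ⟨t, ht, rfl, -⟩ := h
      obtain ⟨ω, hω, hw, hω', hw'⟩ := exists_reduced_cons hy
      obtain ⟨j, hj, he⟩ := exists_eraseIdx_of_length_lt cs ht (i :: ω) (by rwa [hw])
      rw [hw] at he
      rcases j with _ | j
      · rw [List.eraseIdx_zero, List.tail_cons, hw'] at he
        rw [he, cs.simple_mul_simple_cancel_left]
      · rw [List.eraseIdx_cons_succ, cs.wordProd_cons] at he
        have h₁ : cs.simple i * (t * y) = cs.wordProd (ω.eraseIdx j) := by
          rw [he, cs.simple_mul_simple_cancel_left]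
        have h₂ := cs.length_wordProd_le (ω.eraseIdx j)
        rw [← h₁, List.length_eraseIdx_of_lt (by simpa using hj)] at h₂
        have h₃ := hω'.eq
        rw [hw'] at h₃
        simp only [List.length_cons] at hj
        omega

lemma reflTransGen_simple_mul {x y : W} (h : Relation.ReflTransGen (reflLT cs) x y) (i : B) :
    (cs.length y < cs.length (cs.simple i * y) →
      Relation.ReflTransGen (reflLT cs) (cs.simple i * x) (cs.simple i * y)) ∧
    (cs.length (cs.simple i * y) < cs.length y →
      Relation.ReflTransGen (reflLT cs) (cs.simple i * x) y) := by
  induction h with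
  | refl => exact ⟨fun _ => .refl, fun h => .single (reflLT_of_simple_mul_lt h)⟩
  | @tail z y _ hzy ih =>
    have key := hzy.simple_mul_reflTransGen i
    have hz := cs.length_simple_mul z i
    rcases hz with hz | hz
    · have h₁ := ih.1 (by omega)
      exact ⟨fun h => h₁.trans (key.1 h), fun h => h₁.trans (key.2 h)⟩
    · have h₁ := (ih.2 (by omega)).tail hzy
      exact ⟨fun h => h₁.tail (reflLT_simple_mul h), fun _ => h₁⟩

lemma reflTransGen_of_sublist {ω ω' : List B} (hω : cs.IsReduced ω) (h : ω'.Sublist ω) :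
    Relation.ReflTransGen (reflLT cs) (cs.wordProd ω') (cs.wordProd ω) := by
  induction h with
  | slnil => exact .refl
  | @cons l₁ l₂ i _ ih =>
    have h₂ : cs.IsReduced l₂ := by simpa using hω.drop 1
    have hlt : cs.length (cs.wordProd l₂) < cs.length (cs.simple i * cs.wordProd l₂) := by
      rw [← cs.wordProd_cons, hω.eq, h₂.eq, List.length_cons]
      omega
    rw [cs.wordProd_cons]
    exact (ih h₂).tail (reflLT_simple_mul hlt)
  | @cons_cons l₁ l₂ i _ ih =>
    have h₂ : cs.IsReduced l₂ := by simpa using hω.drop 1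
    have hlt : cs.length (cs.wordProd l₂) < cs.length (cs.simple i * cs.wordProd l₂) := by
      rw [← cs.wordProd_cons, hω.eq, h₂.eq, List.length_cons]
      omega
    rw [cs.wordProd_cons, cs.wordProd_cons]
    exact (reflTransGen_simple_mul (ih h₂) i).1 hlt

lemma exists_sublist_of_reflTransGen {x y : W} (h : Relation.ReflTransGen (reflLT cs) x y) :
    ∀ ω, cs.wordProd ω = y → ∃ ω' : List B, ω'.Sublist ω ∧ cs.wordProd ω' = x := by
  induction h with
  | refl => exact fun ω hω => ⟨ω, .refl ω, hω⟩
  | tail _ hzy ih =>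
    obtain ⟨t, ht, rfl, hl⟩ := hzy
    rintro ω rfl
    obtain ⟨j, -, he⟩ := exists_eraseIdx_of_length_lt cs ht ω hl
    obtain ⟨ω', hs, hw⟩ := ih _ he.symm
    exact ⟨ω', hs.trans (List.eraseIdx_sublist _ _), hw⟩

lemma bruhatLE_iff_reflTransGen {x y : W} :
    bruhatLE cs x y ↔ Relation.ReflTransGen (reflLT cs) x y := by
  constructor
  · rintro ⟨ω, hω, rfl, ω', hs, rfl⟩
    exact reflTransGen_of_sublist hω hs
  · intro h
    obtain ⟨ω, hω, rfl⟩ := cs.exists_isReduced y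
    exact ⟨ω, hω, rfl, exists_sublist_of_reflTransGen h ω rfl⟩

/-- The subword property. -/
lemma bruhatLE.exists_sublist {x y : W} (h : bruhatLE cs x y) {ω : List B}
    (hω : cs.wordProd ω = y) : ∃ ω' : List B, ω'.Sublist ω ∧ cs.wordProd ω' = x :=
  exists_sublist_of_reflTransGen (bruhatLE_iff_reflTransGen.1 h) ω hω

lemma bruhatLE_refl (x : W) : bruhatLE cs x x := bruhatLE_iff_reflTransGen.2 .refl

lemma bruhatLE.trans {x y z : W} (h₁ : bruhatLE cs x y) (h₂ : bruhatLE cs y z) :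
    bruhatLE cs x z :=
  bruhatLE_iff_reflTransGen.2
    ((bruhatLE_iff_reflTransGen.1 h₁).trans (bruhatLE_iff_reflTransGen.1 h₂))

lemma bruhatLE.length_le {x y : W} (h : bruhatLE cs x y) : cs.length x ≤ cs.length y := by
  obtain ⟨ω, hω, rfl, ω', hs, rfl⟩ := h
  exact (cs.length_wordProd_le ω').trans (hω.eq ▸ hs.length_le)

lemma bruhatLE.eq_of_length_le {x y : W} (h : bruhatLE cs x y)
    (hl : cs.length y ≤ cs.length x) : x = y := by
  obtain ⟨ω, hω, rfl, ω', hs, rfl⟩ := h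
  have h₁ := cs.length_wordProd_le ω'
  rw [hs.eq_of_length_le (by rw [hω.eq] at hl; omega)]

lemma bruhatLE.inv {x y : W} (h : bruhatLE cs x y) : bruhatLE cs x⁻¹ y⁻¹ := by
  obtain ⟨ω, hω, rfl, ω', hs, rfl⟩ := h
  exact ⟨ω.reverse, hω.reverse, by simp, ω'.reverse, hs.reverse, by simp⟩

lemma bruhatLE_inv_iff {x y : W} : bruhatLE cs x⁻¹ y⁻¹ ↔ bruhatLE cs x y :=
  ⟨fun h => by simpa using h.inv, bruhatLE.inv⟩

lemma bruhatLE_simple_mul {y : W} {i : B} (h : cs.length y < cs.length (cs.simple i * y)) :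
    bruhatLE cs y (cs.simple i * y) :=
  bruhatLE_iff_reflTransGen.2 (.single (reflLT_simple_mul h))

lemma simple_mul_bruhatLE {y : W} {i : B} (h : cs.length (cs.simple i * y) < cs.length y) :
    bruhatLE cs (cs.simple i * y) y :=
  bruhatLE_iff_reflTransGen.2 (.single (reflLT_of_simple_mul_lt h))

lemma bruhatLE.simple_mul_simple_mul {x y : W} (h : bruhatLE cs x y) {i : B}
    (hy : cs.length y < cs.length (cs.simple i * y)) :
    bruhatLE cs (cs.simple i * x) (cs.simple i * y) :=
  bruhatLE_iff_reflTransGen.2 ((reflTransGen_simple_mul (bruhatLE_iff_reflTransGen.1 h) i).1 hy)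

lemma bruhatLE.simple_mul_le {x y : W} (h : bruhatLE cs x y) {i : B}
    (hy : cs.length (cs.simple i * y) < cs.length y) :
    bruhatLE cs (cs.simple i * x) y :=
  bruhatLE_iff_reflTransGen.2 ((reflTransGen_simple_mul (bruhatLE_iff_reflTransGen.1 h) i).2 hy)

lemma bruhatLE.le_or_simple_mul_le {x y : W} (h : bruhatLE cs x y) {i : B}
    (hy : cs.length (cs.simple i * y) < cs.length y) :
    bruhatLE cs x (cs.simple i * y) ∨ bruhatLE cs (cs.simple i * x) (cs.simple i * y) := by
  obtain ⟨ω, -, hw, hω', hw'⟩ := exists_reduced_cons hy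
  obtain ⟨ω', hs, rfl⟩ := h.exists_sublist hw
  rcases hs with _ | _ | _
  · rename_i hs
    exact .inl ⟨ω, hω', hw', ω', hs, rfl⟩
  · rename_i l hs
    exact .inr ⟨ω, hω', hw', l, hs, by rw [cs.wordProd_cons, cs.simple_mul_simple_cancel_left]⟩

lemma bruhatLE.le_simple_mul {x y : W} (h : bruhatLE cs x y) {i : B}
    (hy : cs.length (cs.simple i * y) < cs.length y)
    (hx : cs.length x < cs.length (cs.simple i * x)) :
    bruhatLE cs x (cs.simple i * y) :=
  (h.le_or_simple_mul_le hy).elim id fun h' => (bruhatLE_simple_mul hx).trans h'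

lemma bruhatLE.simple_mul_le_simple_mul {x y : W} (h : bruhatLE cs x y) {i : B}
    (hx : cs.length (cs.simple i * x) < cs.length x)
    (hy : cs.length (cs.simple i * y) < cs.length y) :
    bruhatLE cs (cs.simple i * x) (cs.simple i * y) :=
  (h.le_or_simple_mul_le hy).elim (fun h' => (simple_mul_bruhatLE hx).trans h') id

lemma length_simple_mul_inv (x : W) (i : B) :
    cs.length (cs.simple i * x⁻¹) = cs.length (x * cs.simple i) := by
  rw [← cs.length_inv]
  simp

lemma bruhatLE.mul_simple_mul_simple {x y : W} (h : bruhatLE cs x y) {i : B}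
    (hy : cs.length y < cs.length (y * cs.simple i)) :
    bruhatLE cs (x * cs.simple i) (y * cs.simple i) := by
  rw [← bruhatLE_inv_iff]
  simpa using h.inv.simple_mul_simple_mul (i := i) (by rwa [length_simple_mul_inv, cs.length_inv])

lemma mul_simple_bruhatLE {y : W} {i : B} (h : cs.length (y * cs.simple i) < cs.length y) :
    bruhatLE cs (y * cs.simple i) y := by
  rw [← bruhatLE_inv_iff]
  simpa using simple_mul_bruhatLE (y := y⁻¹) (i := i)
    (by rwa [length_simple_mul_inv, cs.length_inv])

lemma bruhatLE.le_mul_simple {x y : W} (h : bruhatLE cs x y) {i : B}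
    (hy : cs.length (y * cs.simple i) < cs.length y)
    (hx : cs.length x < cs.length (x * cs.simple i)) :
    bruhatLE cs x (y * cs.simple i) := by
  rw [← bruhatLE_inv_iff]
  simpa using h.inv.le_simple_mul (i := i) (by rwa [length_simple_mul_inv, cs.length_inv])
    (by rwa [length_simple_mul_inv, cs.length_inv])

lemma bruhatLE.mul_simple_le_mul_simple {x y : W} (h : bruhatLE cs x y) {i : B}
    (hx : cs.length (x * cs.simple i) < cs.length x)
    (hy : cs.length (y * cs.simple i) < cs.length y) :
    bruhatLE cs (x * cs.simple i) (y * cs.simple i) := by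
  rw [← bruhatLE_inv_iff]
  simpa using h.inv.simple_mul_le_simple_mul (i := i)
    (by rwa [length_simple_mul_inv, cs.length_inv])
    (by rwa [length_simple_mul_inv, cs.length_inv])

lemma bruhatLE.mul_mul {x y u v : W} (h : bruhatLE cs x y) (h' : bruhatLE cs u v)
    (hl : cs.length (y * v) = cs.length y + cs.length v) : bruhatLE cs (x * u) (y * v) := by
  obtain ⟨ω, hω, rfl, ω', hs, rfl⟩ := h
  obtain ⟨η, hη, rfl, η', hs', rfl⟩ := h'
  refine ⟨ω ++ η, ?_, cs.wordProd_append ω η, ω' ++ η', hs.append hs', cs.wordProd_append ω' η'⟩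
  rw [CoxeterSystem.IsReduced, cs.wordProd_append, hl, hω.eq, hη.eq, List.length_append]

/-- If `s x` and `x s'` are both longer than `x` but `s x s'` is shorter than `s x`, then
`s x = x s'`. -/
lemma simple_mul_eq_mul_simple {x : W} {i j : B}
    (h₁ : cs.length x < cs.length (cs.simple i * x))
    (h₂ : cs.length x < cs.length (x * cs.simple j))
    (h₃ : cs.length (cs.simple i * x * cs.simple j) < cs.length (cs.simple i * x)) :
    cs.simple i * x = x * cs.simple j := by
  obtain ⟨ω, hω, rfl⟩ := cs.exists_isReduced x
  rw [← cs.wordProd_cons] at h₃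
  obtain ⟨k, hk, he⟩ := exists_eraseIdx_of_length_mul_lt cs (cs.isReflection_simple j) _ h₃
  rw [cs.wordProd_cons] at he
  rcases k with _ | k
  · rw [List.eraseIdx_zero, List.tail_cons] at he
    simpa using congrArg (· * cs.simple j) he
  · rw [List.eraseIdx_cons_succ, cs.wordProd_cons, mul_assoc, mul_right_inj] at he
    have h₄ := cs.length_wordProd_le (ω.eraseIdx k)
    rw [← he, List.length_eraseIdx_of_lt (by simpa using hk)] at h₄
    rw [hω.eq] at h₂
    omega

end Bruhat

section Parabolic

/-- `a` is a minimal-length representative of `a W_J`, in the form of length additivity. -/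
def IsMinRep (J : Set B) (a : W) : Prop :=
  ∀ u ∈ parabolic cs J, cs.length (a * u) = cs.length a + cs.length u

variable {cs} {J : Set B}

lemma simple_mem_parabolic {j : B} (hj : j ∈ J) : cs.simple j ∈ parabolic cs J :=
  Subgroup.subset_closure ⟨j, hj, rfl⟩

lemma wordProd_mem_parabolic {ω : List B} (h : ∀ j ∈ ω, j ∈ J) :
    cs.wordProd ω ∈ parabolic cs J := by
  induction ω with
  | nil => simp
  | cons i ω ih =>
    rw [cs.wordProd_cons]
    exact mul_mem (simple_mem_parabolic (h i (by simp))) (ih fun j hj => h j (by simp [hj]))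

lemma exists_reduced_mul_simple {ω : List B} (hω : cs.IsReduced ω) (h : ∀ j ∈ ω, j ∈ J) {j : B}
    (hj : j ∈ J) :
    ∃ η : List B, cs.IsReduced η ∧ (∀ k ∈ η, k ∈ J) ∧
      cs.wordProd η = cs.wordProd ω * cs.simple j := by
  rcases cs.length_mul_simple (cs.wordProd ω) j with hl | hl
  · refine ⟨ω ++ [j], ?_, ?_, by simp [cs.wordProd_append]⟩
    · rw [CoxeterSystem.IsReduced, cs.wordProd_append, cs.wordProd_singleton, hl, hω.eq]
      simp
    · intro k hk
      rcases List.mem_append.1 hk with hk | hk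
      · exact h k hk
      · rw [List.mem_singleton.1 hk]
        exact hj
  · obtain ⟨k, hk, he⟩ :=
      exists_eraseIdx_of_length_mul_lt cs (cs.isReflection_simple j) ω (by omega)
    refine ⟨ω.eraseIdx k, ?_, fun k hk => h k (List.mem_of_mem_eraseIdx hk), he.symm⟩
    have := hω.eq
    rw [CoxeterSystem.IsReduced, ← he, List.length_eraseIdx_of_lt hk]
    omega

lemma exists_reduced_of_mem_parabolic {u : W} (hu : u ∈ parabolic cs J) :
    ∃ ω : List B, cs.IsReduced ω ∧ (∀ j ∈ ω, j ∈ J) ∧ cs.wordProd ω = u := by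
  induction hu using Subgroup.closure_induction_right with
  | one => exact ⟨[], by simp [CoxeterSystem.IsReduced], by simp, by simp⟩
  | mul_right x _ y hy ih =>
    obtain ⟨j, hj, rfl⟩ := hy
    obtain ⟨ω, hω, h, rfl⟩ := ih
    exact exists_reduced_mul_simple hω h hj
  | mul_inv_cancel x _ y hy ih =>
    obtain ⟨j, hj, rfl⟩ := hy
    obtain ⟨ω, hω, h, rfl⟩ := ih
    rw [cs.inv_simple]
    exact exists_reduced_mul_simple hω h hj

lemma isMinRep_of_forall_length_le {a : W}
    (ha : ∀ u ∈ parabolic cs J, cs.length a ≤ cs.length (a * u)) : IsMinRep cs J a := by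
  intro u hu
  obtain ⟨ω, hω, h, rfl⟩ := exists_reduced_of_mem_parabolic hu
  clear hu
  induction ω using List.reverseRecOn with
  | nil => simp
  | append_singleton ω j ih =>
    have hω' : cs.IsReduced ω := by simpa using hω.take ω.length
    have hJ : ∀ k ∈ ω, k ∈ J := fun k hk => h k (by simp [hk])
    have ih := ih hω' hJ
    have hred := hω.eq
    have hred' := hω'.eq
    rw [cs.wordProd_append, cs.wordProd_singleton, ← mul_assoc]
    rw [cs.wordProd_append, cs.wordProd_singleton, List.length_append, List.length_singleton]
      at hred
    rcases cs.length_mul_simple (a * cs.wordProd ω) j with hl | hl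
    · omega
    exfalso
    obtain ⟨α, hα, hαa⟩ := cs.exists_isReduced a
    have hl' : cs.length (cs.wordProd (α ++ ω) * cs.simple j) <
        cs.length (cs.wordProd (α ++ ω)) := by
      rw [cs.wordProd_append, ← hαa]
      omega
    obtain ⟨k, hk, he⟩ :=
      exists_eraseIdx_of_length_mul_lt cs (cs.isReflection_simple j) _ hl'
    rw [cs.wordProd_append, ← hαa] at he
    rcases Nat.lt_or_ge k α.length with hkα | hkα
    · rw [List.eraseIdx_append_of_lt_length hkα, cs.wordProd_append] at he
      have h₁ := ha (cs.wordProd ω * cs.simple j * (cs.wordProd ω)⁻¹)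
        (mul_mem (mul_mem (wordProd_mem_parabolic hJ) (simple_mem_parabolic (h j (by simp))))
          (inv_mem (wordProd_mem_parabolic hJ)))
      have h₂ : a * (cs.wordProd ω * cs.simple j * (cs.wordProd ω)⁻¹) =
          cs.wordProd (α.eraseIdx k) := by
        rw [← mul_assoc, ← mul_assoc, he]
        simp
      have h₃ := cs.length_wordProd_le (α.eraseIdx k)
      rw [List.length_eraseIdx_of_lt hkα] at h₃
      have h₄ := hα.eq
      rw [← hαa] at h₄
      rw [h₂] at h₁
      omega
    · rw [List.eraseIdx_append_of_length_le hkα, cs.wordProd_append, ← hαa, mul_assoc,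
        mul_right_inj] at he
      have h₃ := cs.length_wordProd_le (ω.eraseIdx (k - α.length))
      rw [List.length_append] at hk
      rw [List.length_eraseIdx_of_lt (by omega), ← he] at h₃
      omega

lemma isMinRep_minRep (w : W) : IsMinRep cs J (minRep cs J w) := by
  obtain ⟨h₁, h₂⟩ := (exists_minRep cs J w).choose_spec
  refine isMinRep_of_forall_length_le fun u hu => h₂ _ ?_
  rw [mul_inv_rev, mul_assoc]
  exact mul_mem (inv_mem hu) h₁

lemma parPart_mem (w : W) : parPart cs J w ∈ parabolic cs J :=
  (exists_minRep cs J w).choose_spec.1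

lemma minRep_mul_parPart (w : W) : minRep cs J w * parPart cs J w = w := by
  simp [parPart]

lemma IsMinRep.minRep_mul {a u : W} (ha : IsMinRep cs J a) (hu : u ∈ parabolic cs J) :
    minRep cs J (a * u) = a := by
  have h₁ := ha _ (mul_mem hu (inv_mem (parPart_mem (J := J) (cs := cs) (a * u))))
  rw [← mul_assoc, mul_inv_eq_of_eq_mul (minRep_mul_parPart (a * u)).symm] at h₁
  have h₂ := (exists_minRep cs J (a * u)).choose_spec.2 a (by simpa using hu)
  have h₃ : u * (parPart cs J (a * u))⁻¹ = 1 := by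
    rw [← cs.length_eq_zero_iff]
    change cs.length (minRep cs J (a * u)) ≤ _ at h₂
    omega
  have h₄ : minRep cs J (a * u) = a * (u * (parPart cs J (a * u))⁻¹) := by
    rw [← mul_assoc]
    exact (mul_inv_eq_of_eq_mul (minRep_mul_parPart (a * u)).symm).symm
  rw [h₄, h₃, mul_one]

lemma IsMinRep.parPart_mul {a u : W} (ha : IsMinRep cs J a) (hu : u ∈ parabolic cs J) :
    parPart cs J (a * u) = u := by
  rw [parPart, ha.minRep_mul hu, inv_mul_cancel_left]

lemma isMinRep_one : IsMinRep cs J (1 : W) := fun u _ => by simp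

/-- Deodhar's lemma: multiplying a minimal representative by `s` on the left gives either a minimal
representative, or moves `s` to a simple reflection of `W_J` on the right. -/
lemma IsMinRep.simple_mul {a : W} (ha : IsMinRep cs J a) (i : B) :
    IsMinRep cs J (cs.simple i * a) ∨ ∃ j ∈ J, cs.simple i * a = a * cs.simple j := by
  by_cases h : ∃ j ∈ J, cs.length (cs.simple i * a * cs.simple j) < cs.length (cs.simple i * a)
  · right
    obtain ⟨j, hj, hl⟩ := h
    refine ⟨j, hj, ?_⟩
    have h₁ := ha _ (simple_mem_parabolic hj)
    rw [cs.length_simple] at h₁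
    have h₂ := cs.length_simple_mul a i
    have h₃ := cs.length_simple_mul (a * cs.simple j) i
    have h₄ := cs.length_mul_simple (cs.simple i * a) j
    rw [← mul_assoc] at h₃
    exact simple_mul_eq_mul_simple (by omega) (by omega) hl
  · left
    push Not at h
    have hm := isMinRep_minRep (cs := cs) (J := J) (cs.simple i * a)
    have hp := minRep_mul_parPart (cs := cs) (J := J) (cs.simple i * a)
    have hu := parPart_mem (cs := cs) (J := J) (cs.simple i * a)
    set m := minRep cs J (cs.simple i * a)
    set u := parPart cs J (cs.simple i * a)
    rw [← hp]
    obtain ⟨ω, hω, hJ, hωu⟩ := exists_reduced_of_mem_parabolic hu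
    rcases List.eq_nil_or_concat' ω with rfl | ⟨η, j, rfl⟩
    · rw [cs.wordProd_nil] at hωu
      rwa [← hωu, mul_one]
    · exfalso
      have hj : j ∈ J := hJ j (by simp)
      have h₁ := h j hj
      have h₂ : u * cs.simple j = cs.wordProd η := by
        rw [← hωu, cs.wordProd_append]
        simp
      have h₃ := cs.length_wordProd_le η
      have h₄ := hω.eq
      rw [hωu, List.length_append, List.length_singleton] at h₄
      rw [← hp, mul_assoc, hm _ (mul_mem hu (simple_mem_parabolic hj)), hm _ hu, h₂] at h₁
      omega

lemma IsMinRep.bruhatLE_mul {a u v : W} (ha : IsMinRep cs J a) (hv : v ∈ parabolic cs J)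
    (h : bruhatLE cs u v) : bruhatLE cs (a * u) (a * v) :=
  (bruhatLE_refl a).mul_mul h (ha v hv)

/-- If `p ≤ q` then each `u⁻¹ p` with `u ∈ W_J` lies below some `v⁻¹ q` with `v ≤ u`. -/
lemma bruhatLE.exists_inv_mul {p q u : W} (h : bruhatLE cs p q) (hu : u ∈ parabolic cs J) :
    ∃ v ∈ parabolic cs J, bruhatLE cs v u ∧ bruhatLE cs (u⁻¹ * p) (v⁻¹ * q) := by
  obtain ⟨ω, hω, hJ, rfl⟩ := exists_reduced_of_mem_parabolic hu
  clear hu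
  induction ω using List.reverseRecOn with
  | nil => exact ⟨1, one_mem _, by simpa using bruhatLE_refl 1, by simpa using h⟩
  | append_singleton ω j ih =>
    have hω' : cs.IsReduced ω := by simpa using hω.take ω.length
    obtain ⟨v, hv, hvu, hle⟩ := ih hω' fun k hk => hJ k (by simp [hk])
    have hred := hω.eq
    have hred' := hω'.eq
    rw [cs.wordProd_append, cs.wordProd_singleton, List.length_append, List.length_singleton]
      at hred
    rw [cs.wordProd_append, cs.wordProd_singleton, mul_inv_rev, cs.inv_simple, mul_assoc]
    have hlt : cs.length (cs.wordProd ω) < cs.length (cs.wordProd ω * cs.simple j) := by omega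
    rcases cs.length_simple_mul (v⁻¹ * q) j with hl | hl
    · refine ⟨v * cs.simple j, mul_mem hv (simple_mem_parabolic (hJ j (by simp))),
        hvu.mul_simple_mul_simple hlt, ?_⟩
      rw [mul_inv_rev, cs.inv_simple, mul_assoc]
      exact hle.simple_mul_simple_mul (by omega)
    · refine ⟨v, hv, ?_, hle.simple_mul_le (by omega)⟩
      have := hvu.mul_mul (bruhatLE_iff_reflTransGen.2 (reflTransGen_of_sublist
        (cs := cs) (ω := [j]) (by simp [CoxeterSystem.IsReduced]) (List.nil_sublist _)))
        (by simpa using hred'.symm ▸ hred)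
      simpa using this

end Parabolic

section TwistedOrder

variable {cs} {J : Set B}

lemma length_simple_mul_minRep {c : W} (hc : IsMinRep cs J c) {i j : B} (hj : j ∈ J)
    (h : cs.simple i * c = c * cs.simple j) :
    cs.length (cs.simple i * c) = cs.length c + 1 := by
  rw [h, hc _ (simple_mem_parabolic hj), cs.length_simple]

lemma simple_mul_cases (w : W) (i : B) :
    (IsMinRep cs J (cs.simple i * minRep cs J w) ∧
      minRep cs J (cs.simple i * w) = cs.simple i * minRep cs J w ∧
      parPart cs J (cs.simple i * w) = parPart cs J w) ∨
    ∃ j ∈ J, cs.simple i * minRep cs J w = minRep cs J w * cs.simple j ∧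
      minRep cs J (cs.simple i * w) = minRep cs J w ∧
      parPart cs J (cs.simple i * w) = cs.simple j * parPart cs J w := by
  have hp := parPart_mem (cs := cs) (J := J) w
  have hm := isMinRep_minRep (cs := cs) (J := J) w
  rcases hm.simple_mul i with h | ⟨j, hj, h⟩
  · have hw : cs.simple i * w = cs.simple i * minRep cs J w * parPart cs J w := by
      rw [mul_assoc, minRep_mul_parPart]
    exact .inl ⟨h, by rw [hw, h.minRep_mul hp], by rw [hw, h.parPart_mul hp]⟩
  · have hw : cs.simple i * w = minRep cs J w * (cs.simple j * parPart cs J w) := by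
      rw [← mul_assoc, ← h, mul_assoc, minRep_mul_parPart]
    have hp' := mul_mem (simple_mem_parabolic hj) hp
    exact .inr ⟨j, hj, h, by rw [hw, hm.minRep_mul hp'], by rw [hw, hm.parPart_mul hp']⟩

lemma twistedLE_refl (w : W) : twistedLE cs J w w :=
  ⟨1, one_mem _, by simpa using bruhatLE_refl _, by simpa using bruhatLE_refl _⟩

lemma twistedLE.trans {x y z : W} (h₁ : twistedLE cs J x y) (h₂ : twistedLE cs J y z) :
    twistedLE cs J x z := by
  obtain ⟨u, hu, h₁, h₁'⟩ := h₁
  obtain ⟨v, hv, h₂, h₂'⟩ := h₂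
  obtain ⟨v', hv', hle, h₃⟩ := h₁'.exists_inv_mul hv
  refine ⟨u * v', mul_mem hu hv', ?_, ?_⟩
  · rw [← mul_assoc]
    exact (h₁.mul_mul hle (isMinRep_minRep y _ hv)).trans h₂
  · rw [mul_inv_rev, mul_assoc]
    exact h₂'.trans h₃

lemma twistedLE.twistedLength_lt {v w : W} (h : twistedLE cs J v w) (hne : v ≠ w) :
    twistedLength cs J v < twistedLength cs J w := by
  obtain ⟨u, hu, h₁, h₂⟩ := h
  have ha := isMinRep_minRep (cs := cs) (J := J) v _ hu
  have l₁ := h₁.length_le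
  have l₂ := h₂.length_le
  have l₃ := cs.length_mul_le u⁻¹ (parPart cs J v)
  rw [cs.length_inv] at l₃
  by_contra hlt
  rw [twistedLength, twistedLength] at hlt
  have e₁ := h₁.eq_of_length_le (by omega)
  have e₂ := h₂.eq_of_length_le (by omega)
  apply hne
  rw [← minRep_mul_parPart (cs := cs) (J := J) v, ← minRep_mul_parPart (cs := cs) (J := J) w,
    e₂, ← e₁]
  group

lemma twistedLength_simple_mul (w : W) (i : B) :
    twistedLength cs J (cs.simple i * w) = twistedLength cs J w + 1 ∨
      twistedLength cs J (cs.simple i * w) = twistedLength cs J w - 1 := by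
  rw [twistedLength, twistedLength]
  rcases simple_mul_cases (cs := cs) (J := J) w i with ⟨-, h₁, h₂⟩ | ⟨j, -, -, h₁, h₂⟩
  · have := cs.length_simple_mul (minRep cs J w) i
    rw [h₁, h₂]
    omega
  · have := cs.length_simple_mul (parPart cs J w) j
    rw [h₁, h₂]
    omega

lemma twistedLE_simple_mul {w : W} {i : B}
    (h : twistedLength cs J (cs.simple i * w) = twistedLength cs J w + 1) :
    twistedLE cs J w (cs.simple i * w) := by
  rw [twistedLength, twistedLength] at h
  rcases simple_mul_cases (cs := cs) (J := J) w i with ⟨-, h₁, h₂⟩ | ⟨j, -, -, h₁, h₂⟩ <;>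
    rw [h₁, h₂] at h <;> refine ⟨1, one_mem _, ?_, ?_⟩ <;>
    simp only [mul_one, inv_one, one_mul, h₁, h₂]
  · exact bruhatLE_simple_mul (by omega)
  · exact bruhatLE_refl _
  · exact bruhatLE_refl _
  · exact simple_mul_bruhatLE (by omega)

lemma bruhatLE.exists_simple_mul_le {x c : W} (h : bruhatLE cs x c) {i j : B}
    (hij : cs.simple i * c = c * cs.simple j) (hc : cs.length c < cs.length (cs.simple i * c)) :
    (cs.length (cs.simple i * x * cs.simple j) < cs.length (cs.simple i * x) ∧
      bruhatLE cs (cs.simple i * x * cs.simple j) c) ∨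
    (cs.length (cs.simple i * x) < cs.length (cs.simple i * x * cs.simple j) ∧
      bruhatLE cs (cs.simple i * x) c) := by
  have h₁ := h.simple_mul_simple_mul hc
  rw [hij] at h₁ hc
  have hcj : c * cs.simple j * cs.simple j = c := by simp
  rcases cs.length_mul_simple (cs.simple i * x) j with hl | hl
  · right
    refine ⟨by omega, ?_⟩
    simpa using h₁.le_mul_simple (i := j) (by rwa [hcj]) (by omega)
  · left
    refine ⟨by omega, ?_⟩
    simpa using h₁.mul_simple_le_mul_simple (i := j) (by omega) (by rwa [hcj])

lemma bruhatLE.le_simple_mul_of_lt {d q : W} (h : bruhatLE cs d q) {j : B}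
    (hd : cs.length d < cs.length (cs.simple j * d)) : bruhatLE cs d (cs.simple j * q) := by
  rcases cs.length_simple_mul q j with hl | hl
  · exact h.trans (bruhatLE_simple_mul (by omega))
  · exact h.le_simple_mul (by omega) hd

lemma bruhatLE.simple_mul_le_or {d q : W} (h : bruhatLE cs d q) (j : B) :
    bruhatLE cs (cs.simple j * d) q ∨ bruhatLE cs (cs.simple j * d) (cs.simple j * q) := by
  rcases cs.length_simple_mul q j with hl | hl
  · exact .inr (h.simple_mul_simple_mul (by omega))
  · exact .inl (h.simple_mul_le (by omega))

/-- If `x ≤ c` and `s c = c s' > c`, then `s x s' ≤ c` as soon as `s` is a left descent of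
`x s'`. -/
lemma bruhatLE.conj_simple_le {x c : W} (h : bruhatLE cs x c) {i j : B}
    (hij : cs.simple i * c = c * cs.simple j) (hc : cs.length c < cs.length (cs.simple i * c))
    (hx : cs.length (cs.simple i * (x * cs.simple j)) < cs.length (x * cs.simple j)) :
    bruhatLE cs (cs.simple i * (x * cs.simple j)) c := by
  have h₁ := h.mul_simple_mul_simple (i := j) (hij ▸ hc)
  rw [← hij] at h₁
  simpa using h₁.simple_mul_le_simple_mul hx (by simpa using hc)

variable {a b c d u : W}

/-- The order `≤^J` in terms of the two factors of each element. -/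
def PairLE (cs : CoxeterSystem M W) (J : Set B) (a b c d : W) : Prop :=
  ∃ u ∈ parabolic cs J, bruhatLE cs (a * u) c ∧ bruhatLE cs d (u⁻¹ * b)

lemma PairLE.lift_left_left {i : B} (h : PairLE cs J a b c d)
    (hsa : IsMinRep cs J (cs.simple i * a))
    (ha : IsMinRep cs J a) (hla : cs.length a < cs.length (cs.simple i * a))
    (hlc : cs.length (cs.simple i * c) < cs.length c) :
    PairLE cs J (cs.simple i * a) b c d ∧ PairLE cs J a b (cs.simple i * c) d := by
  obtain ⟨u, hu, h₁, h₂⟩ := h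
  refine ⟨⟨u, hu, ?_, h₂⟩, ⟨u, hu, ?_, h₂⟩⟩
  · rw [mul_assoc]
    exact h₁.simple_mul_le hlc
  · refine h₁.le_simple_mul hlc ?_
    rw [← mul_assoc, ha u hu, hsa u hu]
    omega

lemma PairLE.lift_left_right {i k : B} (h : PairLE cs J a b c d) (hk : k ∈ J)
    (ha : IsMinRep cs J a) (hik : cs.simple i * a = a * cs.simple k)
    (hlb : cs.length (cs.simple k * b) < cs.length b)
    (hlc : cs.length (cs.simple i * c) < cs.length c) :
    PairLE cs J a (cs.simple k * b) c d ∧ PairLE cs J a b (cs.simple i * c) d := by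
  obtain ⟨u, hu, h₁, h₂⟩ := h
  have hk' := simple_mem_parabolic (cs := cs) hk
  have hau : cs.simple i * (a * u) = a * (cs.simple k * u) := by
    rw [← mul_assoc, hik, mul_assoc]
  constructor
  · refine ⟨cs.simple k * u, mul_mem hk' hu, ?_, by simpa [mul_assoc] using h₂⟩
    rw [← hau]
    exact h₁.simple_mul_le hlc
  · have l₁ := ha u hu
    have l₂ := ha _ (mul_mem hk' hu)
    rcases cs.length_simple_mul u k with hl | hl
    · exact ⟨u, hu, h₁.le_simple_mul hlc (by rw [hau]; omega), h₂⟩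
    · have h₃ := h₁.simple_mul_le_simple_mul (by rw [hau]; omega) hlc
      rw [hau] at h₃
      obtain ⟨v, hv, hvu, h₄⟩ :=
        (simple_mul_bruhatLE hlb).exists_inv_mul (mul_mem hk' hu)
      refine ⟨v, hv, (ha.bruhatLE_mul (mul_mem hk' hu) hvu).trans h₃, h₂.trans ?_⟩
      simpa [mul_assoc] using h₄

lemma PairLE.lift_right_left {i j : B} (h : PairLE cs J a b c d) (hj : j ∈ J)
    (ha : IsMinRep cs J a) (hsa : IsMinRep cs J (cs.simple i * a))
    (hla : cs.length a < cs.length (cs.simple i * a))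
    (hij : cs.simple i * c = c * cs.simple j) (hlc : cs.length c < cs.length (cs.simple i * c))
    (hld : cs.length d < cs.length (cs.simple j * d)) :
    PairLE cs J (cs.simple i * a) b c d ∧ PairLE cs J a b c (cs.simple j * d) := by
  obtain ⟨u, hu, h₁, h₂⟩ := h
  have huj := mul_mem hu (simple_mem_parabolic (cs := cs) hj)
  have l₁ := ha u hu
  have l₂ := hsa u hu
  have l₃ := ha _ huj
  have l₄ := hsa _ huj
  have hsau := h₁.exists_simple_mul_le hij hlc
  constructor
  · rcases hsau with ⟨-, h₃⟩ | ⟨-, h₃⟩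
    · refine ⟨u * cs.simple j, huj, by simpa [mul_assoc] using h₃, ?_⟩
      rw [mul_inv_rev, cs.inv_simple, mul_assoc]
      exact h₂.le_simple_mul_of_lt hld
    · exact ⟨u, hu, by simpa [mul_assoc] using h₃, h₂⟩
  · rcases h₂.simple_mul_le_or j with h₄ | h₄
    · exact ⟨u, hu, h₁, h₄⟩
    · refine ⟨u * cs.simple j, huj, ?_, by simpa [mul_assoc] using h₄⟩
      rcases cs.length_mul_simple u j with hl | hl
      · rcases hsau with ⟨h₃, -⟩ | ⟨-, h₃⟩
        · simp only [mul_assoc] at h₃ l₄ l₂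
          omega
        · have h₅ := h₃.conj_simple_le hij hlc
          simp only [mul_assoc, cs.simple_mul_simple_cancel_left] at h₅ l₄
          exact h₅ (by omega)
      · exact (ha.bruhatLE_mul hu (mul_simple_bruhatLE (by omega))).trans h₁

lemma PairLE.lift_right_right {i j k : B} (h : PairLE cs J a b c d) (hj : j ∈ J) (hk : k ∈ J)
    (ha : IsMinRep cs J a) (hik : cs.simple i * a = a * cs.simple k)
    (hlb : cs.length (cs.simple k * b) < cs.length b)
    (hij : cs.simple i * c = c * cs.simple j) (hlc : cs.length c < cs.length (cs.simple i * c))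
    (hld : cs.length d < cs.length (cs.simple j * d)) :
    PairLE cs J a (cs.simple k * b) c d ∧ PairLE cs J a b c (cs.simple j * d) := by
  obtain ⟨u, hu, h₁, h₂⟩ := h
  have hj' := simple_mem_parabolic (cs := cs) hj
  have hk' := simple_mem_parabolic (cs := cs) hk
  have huj := mul_mem hu hj'
  have hku := mul_mem hk' hu
  have hkuj := mul_mem hk' huj
  have hsa : ∀ y, cs.simple i * (a * y) = a * (cs.simple k * y) := fun y => by
    rw [← mul_assoc, hik, mul_assoc]
  have l₁ := ha _ hu
  have l₂ := ha _ huj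
  have l₃ := ha _ hku
  have l₄ := ha _ hkuj
  have hsau := h₁.exists_simple_mul_le hij hlc
  simp only [hsa, mul_assoc] at hsau
  have m₁ := cs.length_mul_simple u j
  have m₂ := cs.length_simple_mul u k
  have m₃ := cs.length_mul_simple (cs.simple k * u) j
  have m₄ := cs.length_simple_mul (u * cs.simple j) k
  rw [mul_assoc] at m₃
  constructor
  · rcases m₂ with hl | hl
    · rcases hsau with ⟨-, h₃⟩ | ⟨-, h₃⟩
      · refine ⟨_, hkuj, h₃, ?_⟩
        simpa [mul_assoc] using h₂.le_simple_mul_of_lt hld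
      · exact ⟨_, hku, h₃, by simpa [mul_assoc] using h₂⟩
    · refine ⟨_, hku, (ha.bruhatLE_mul hu (simple_mul_bruhatLE (by omega))).trans h₁, ?_⟩
      simpa [mul_assoc] using h₂
  · rcases h₂.simple_mul_le_or j with h₄ | h₄
    · exact ⟨u, hu, h₁, h₄⟩
    rcases m₁ with hl₁ | hl₁
    swap
    · exact ⟨_, huj, (ha.bruhatLE_mul hu (mul_simple_bruhatLE (by omega))).trans h₁,
        by simpa [mul_assoc] using h₄⟩
    -- It suffices to find `v ∈ W_J` with `a v ≤ c` and `s' u⁻¹ b = v⁻¹ (s'' b)`.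
    have key : ∀ v ∈ parabolic cs J, bruhatLE cs (a * v) c →
        cs.simple j * (u⁻¹ * b) = v⁻¹ * (cs.simple k * b) →
        PairLE cs J a b c (cs.simple j * d) := by
      intro v hv hvc he
      obtain ⟨v', hv', hle, h₅⟩ := (simple_mul_bruhatLE hlb).exists_inv_mul hv
      exact ⟨v', hv', (ha.bruhatLE_mul hv hle).trans hvc, (he ▸ h₄).trans h₅⟩
    rcases m₂ with hl₂ | hl₂
    · rcases hsau with ⟨h₃, -⟩ | ⟨h₃, h₃'⟩
      · have e := simple_mul_eq_mul_simple (cs := cs) (x := u) (i := k) (j := j) (by omega)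
          (by omega) (by rw [mul_assoc]; omega)
        refine key u hu h₁ ?_
        have e' := congrArg (·⁻¹) e
        simp only [mul_inv_rev, cs.inv_simple] at e'
        rw [← mul_assoc, ← mul_assoc, e']
      · refine ⟨_, huj, ?_, by simpa [mul_assoc] using h₄⟩
        have h₅ := h₃'.conj_simple_le hij hlc
        simp only [mul_assoc, hsa, cs.simple_mul_simple_cancel_left] at h₅
        exact h₅ (by omega)
    · refine key _ hkuj ?_ (by simp [mul_assoc])
      have h₅ := h₁.conj_simple_le hij hlc
      simp only [mul_assoc, hsa] at h₅
      exact h₅ (by omega)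

/-- The lifting property of `≤^J`. -/
lemma twistedLE.lift {v w : W} (h : twistedLE cs J v w) {i : B}
    (hw : twistedLength cs J (cs.simple i * w) = twistedLength cs J w - 1)
    (hv : twistedLength cs J (cs.simple i * v) = twistedLength cs J v + 1) :
    twistedLE cs J (cs.simple i * v) w ∧ twistedLE cs J v (cs.simple i * w) := by
  have hc := isMinRep_minRep (cs := cs) (J := J) w
  have ha := isMinRep_minRep (cs := cs) (J := J) v
  change PairLE cs J _ _ _ _ at h
  change PairLE cs J _ _ _ _ ∧ PairLE cs J _ _ _ _
  simp only [twistedLength] at hw hv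
  rcases simple_mul_cases (cs := cs) (J := J) w i with ⟨-, w₁, w₂⟩ | ⟨j, hj, hij, w₁, w₂⟩ <;>
  rcases simple_mul_cases (cs := cs) (J := J) v i with ⟨hsa, v₁, v₂⟩ | ⟨k, hk, hik, v₁, v₂⟩ <;>
  simp only [w₁, w₂, v₁, v₂] at hw hv ⊢
  · exact h.lift_left_left hsa ha (by omega) (by omega)
  · exact h.lift_left_right hk ha hik (by omega) (by omega)
  · have := length_simple_mul_minRep hc hj hij
    exact h.lift_right_left hj ha hsa (by omega) hij (by omega) (by omega)
  · have := length_simple_mul_minRep hc hj hij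
    exact h.lift_right_right hj hk ha hik (by omega) hij (by omega) (by omega)

end TwistedOrder

section Lifting

variable {α : Type*} {le : α → α → Prop} {r : α → ℤ} {σ : α → α}

/-- `le` is reflexive and transitive, and `r` is strictly monotone for it. -/
structure IsRankedOrder (le : α → α → Prop) (r : α → ℤ) : Prop where
  refl : ∀ x, le x x
  trans : ∀ {x y z}, le x y → le y z → le x z
  rank_lt : ∀ {x y}, le x y → x ≠ y → r x < r y

/-- `σ` is an involution changing ranks by one, sending each element to a comparable one, and
having the lifting property. -/
structure IsLifting (le : α → α → Prop) (r : α → ℤ) (σ : α → α) : Prop where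
  invol : ∀ x, σ (σ x) = x
  rank : ∀ x, r (σ x) = r x + 1 ∨ r (σ x) = r x - 1
  le_self : ∀ {x}, r (σ x) = r x + 1 → le x (σ x)
  lift : ∀ {x y}, le x y → r (σ y) = r y - 1 → r (σ x) = r x + 1 → le (σ x) y ∧ le x (σ y)

/-- The pair `(v, w)` has an element strictly in between if its rank is at least two, and exactly
two such elements if its rank is two. -/
def IsThinPair (le : α → α → Prop) (r : α → ℤ) (v w : α) : Prop :=
  (r v + 2 ≤ r w → ∃ z, le v z ∧ le z w ∧ r v < r z ∧ r z < r w) ∧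
  (r w = r v + 2 → ∃ a b, a ≠ b ∧ ∀ z, (le v z ∧ le z w ∧ r z = r v + 1) ↔ z = a ∨ z = b)

lemma IsRankedOrder.dual (h : IsRankedOrder le r) : IsRankedOrder (flip le) (fun x => -r x) where
  refl := h.refl
  trans h₁ h₂ := h.trans h₂ h₁
  rank_lt h₁ hne := neg_lt_neg (h.rank_lt h₁ hne.symm)

lemma IsRankedOrder.eq_of_rank_le (h : IsRankedOrder le r) {x y : α} (hxy : le x y)
    (hr : r y ≤ r x) : x = y := by
  by_contra hne
  exact absurd (h.rank_lt hxy hne) (not_lt.2 hr)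

lemma IsRankedOrder.rank_le (h : IsRankedOrder le r) {x y : α} (hxy : le x y) : r x ≤ r y := by
  by_cases hne : x = y
  · rw [hne]
  · exact (h.rank_lt hxy hne).le

lemma IsLifting.self_le (h : IsLifting le r σ) {x : α} (hx : r (σ x) = r x - 1) :
    le (σ x) x := by
  have := h.le_self (x := σ x) (by rw [h.invol]; omega)
  rwa [h.invol] at this

lemma IsLifting.dual (h : IsLifting le r σ) : IsLifting (flip le) (fun x => -r x) σ where
  invol := h.invol
  rank x := by
    have := h.rank x
    omega
  le_self {x} hx := h.self_le (by omega)
  lift {x y} hxy hy hx := (h.lift hxy (by omega) (by omega)).symm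

lemma IsThinPair.dual {v w : α} (h : IsThinPair le r v w) :
    IsThinPair (flip le) (fun x => -r x) w v := by
  simp only [IsThinPair, flip]
  refine ⟨fun hr => ?_, fun hr => ?_⟩
  · obtain ⟨z, h₁, h₂, h₃, h₄⟩ := h.1 (by omega)
    exact ⟨z, h₂, h₁, by omega, by omega⟩
  · obtain ⟨a, b, hab, H⟩ := h.2 (by omega)
    refine ⟨a, b, hab, fun z => ?_⟩
    rw [← H z]
    constructor
    · rintro ⟨h₁, h₂, h₃⟩
      exact ⟨h₂, h₁, by omega⟩
    · rintro ⟨h₁, h₂, h₃⟩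
      exact ⟨h₂, h₁, by omega⟩

lemma isThinPair_dual_iff {v w : α} :
    IsThinPair (flip le) (fun x => -r x) w v ↔ IsThinPair le r v w := by
  refine ⟨fun h => ?_, IsThinPair.dual⟩
  have h' := h.dual
  simp only [neg_neg] at h'
  exact h'

lemma IsLifting.map_le_map (hσ : IsLifting le r σ) (hr : IsRankedOrder le r) {v w : α}
    (hvw : le v w) (hw : r (σ w) = r w - 1) (hv : r (σ v) = r v - 1) : le (σ v) (σ w) :=
  (hσ.lift (hr.trans (hσ.self_le hv) hvw) hw (by rw [hσ.invol]; omega)).2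

lemma IsLifting.isThinPair_of_ascent (hσ : IsLifting le r σ) (hr : IsRankedOrder le r) {v w : α}
    (hvw : le v w) (hw : r (σ w) = r w - 1) (hv : r (σ v) = r v + 1) : IsThinPair le r v w := by
  obtain ⟨h₁, h₂⟩ := hσ.lift hvw hw hv
  refine ⟨fun h => ⟨σ w, h₂, hσ.self_le hw, by omega, by omega⟩, fun h => ?_⟩
  refine ⟨σ v, σ w, fun he => ?_, fun z => ⟨?_, ?_⟩⟩
  · have := congrArg σ he
    rw [hσ.invol, hσ.invol] at this
    rw [this] at h
    omega
  · rintro ⟨hvz, hzw, hz⟩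
    rcases hσ.rank z with hσz | hσz
    · exact .inr (hr.eq_of_rank_le (hσ.lift hzw hw hσz).2 (by omega))
    · left
      rw [hr.eq_of_rank_le (hσ.lift hvz hσz hv).2 (by omega), hσ.invol]
  · rintro (rfl | rfl)
    · exact ⟨hσ.le_self hv, h₁, hv⟩
    · exact ⟨h₂, hσ.self_le hw, by omega⟩

lemma IsLifting.isThinPair_of_descent (hσ : IsLifting le r σ) (hr : IsRankedOrder le r) {v w : α}
    (hw : r (σ w) = r w - 1) (hv : r (σ v) = r v - 1)
    (ih : IsThinPair le r (σ v) (σ w)) : IsThinPair le r v w := by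
  -- Elements between `σ v` and `σ w` either are moved between `v` and `w`, or lie above `v`.
  have up : ∀ z, le (σ v) z → le z (σ w) → r (σ z) = r z + 1 → le v (σ z) ∧ le (σ z) w := by
    intro z h₁ h₂ hz
    constructor
    · have h₃ := (hσ.lift (hr.trans h₁ (hσ.le_self hz)) (by rw [hσ.invol]; omega)
        (by rw [hσ.invol]; omega)).1
      rwa [hσ.invol] at h₃
    · exact (hσ.lift (hr.trans h₂ (hσ.self_le hw)) hw hz).1
  have down : ∀ z, le (σ v) z → r (σ z) = r z - 1 → le v z := by
    intro z h₁ hz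
    have h₃ := (hσ.lift h₁ hz (by rw [hσ.invol]; omega)).1
    rwa [hσ.invol] at h₃
  constructor
  · intro h
    obtain ⟨z, h₁, h₂, h₃, h₄⟩ := ih.1 (by omega)
    rcases hσ.rank z with hz | hz
    · exact ⟨σ z, (up z h₁ h₂ hz).1, (up z h₁ h₂ hz).2, by omega, by omega⟩
    · have hvz := down z h₁ hz
      by_cases hne : v = z
      · subst hne
        exact ⟨σ w, h₂, hσ.self_le hw, by omega, by omega⟩
      · exact ⟨z, hvz, hr.trans h₂ (hσ.self_le hw), hr.rank_lt hvz hne, by omega⟩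
  · intro h
    obtain ⟨a, b, hab, H⟩ := ih.2 (by omega)
    have hσinj : ∀ x y, σ x = σ y → x = y := fun x y he => by
      rw [← hσ.invol x, he, hσ.invol]
    -- The middle elements correspond under `z ↦ σ z` (ascents) and `v ↦ σ w` (descents).
    let f : α → α := fun z => if r (σ z) = r z + 1 then σ z else σ w
    have hdown : ∀ z, z = a ∨ z = b → r (σ z) = r z - 1 → z = v := by
      intro z hz hd
      obtain ⟨h₁, h₂, h₃⟩ := (H z).2 hz
      exact (hr.eq_of_rank_le (down z h₁ hd) (by omega)).symm
    have hne : ∀ z, z = a ∨ z = b → z ≠ w := by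
      rintro z hz rfl
      obtain ⟨h₁, h₂, h₃⟩ := (H z).2 hz
      omega
    refine ⟨f a, f b, ?_, fun z => ⟨?_, ?_⟩⟩
    · intro he
      simp only [f] at he
      split_ifs at he with ha hb hb
      · exact hab (hσinj _ _ he)
      · exact hne a (.inl rfl) (hσinj _ _ he)
      · exact hne b (.inr rfl) (hσinj _ _ he.symm)
      · apply hab
        rw [hdown a (.inl rfl) ((hσ.rank a).resolve_left ha),
          hdown b (.inr rfl) ((hσ.rank b).resolve_left hb)]
    · rintro ⟨h₁, h₂, h₃⟩
      rcases hσ.rank z with hz | hz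
      · have hzw : z = σ w := hr.eq_of_rank_le (hσ.lift h₂ hw hz).2 (by omega)
        have hmem := (H v).1 ⟨hσ.self_le hv, hzw ▸ h₁, by omega⟩
        have hfv : f v = z := by
          simp only [f]
          rw [if_neg (by omega), hzw]
        rcases hmem with rfl | rfl
        · exact .inl hfv.symm
        · exact .inr hfv.symm
      · have hmem := (H (σ z)).1 ⟨hσ.map_le_map hr h₁ hz hv, hσ.map_le_map hr h₂ hw hz, by omega⟩
        have hfz : f (σ z) = z := by
          simp only [f]
          rw [if_pos (by rw [hσ.invol]; omega), hσ.invol]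
        rcases hmem with h | h
        · exact .inl (by rw [← h, hfz])
        · exact .inr (by rw [← h, hfz])
    · intro hz
      obtain ⟨x, hx, rfl⟩ : ∃ x, (x = a ∨ x = b) ∧ z = f x :=
        hz.elim (fun h => ⟨a, .inl rfl, h⟩) (fun h => ⟨b, .inr rfl, h⟩)
      obtain ⟨h₁, h₂, h₃⟩ := (H x).2 hx
      simp only [f]
      split_ifs with hx'
      · exact ⟨(up x h₁ h₂ hx').1, (up x h₁ h₂ hx').2, by omega⟩
      · have hxv := hdown x hx ((hσ.rank x).resolve_left hx')
        exact ⟨hxv ▸ h₂, hσ.self_le hw, by omega⟩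

/-- Thinness may be checked after applying `σ`, if `σ` lowers the upper end. -/
lemma IsLifting.isThinPair_of_lower (hσ : IsLifting le r σ) (hr : IsRankedOrder le r) {v w : α}
    (hvw : le v w) (hw : r (σ w) = r w - 1)
    (ih : r (σ v) = r v - 1 → le (σ v) (σ w) → IsThinPair le r (σ v) (σ w)) :
    IsThinPair le r v w := by
  rcases hσ.rank v with hv | hv
  · exact hσ.isThinPair_of_ascent hr hvw hw hv
  · exact hσ.isThinPair_of_descent hr hw hv (ih hv (hσ.map_le_map hr hvw hw hv))

/-- Thinness may be checked after applying `σ`, if `σ` raises the lower end. -/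
lemma IsLifting.isThinPair_of_raise (hσ : IsLifting le r σ) (hr : IsRankedOrder le r) {v w : α}
    (hvw : le v w) (hv : r (σ v) = r v + 1)
    (ih : r (σ w) = r w + 1 → le (σ v) (σ w) → IsThinPair le r (σ v) (σ w)) :
    IsThinPair le r v w := by
  rw [← isThinPair_dual_iff]
  exact hσ.dual.isThinPair_of_lower hr.dual hvw (by omega)
    fun h₁ h₂ => isThinPair_dual_iff.2 (ih (by omega) h₂)

end Lifting

section TwistedThin

variable {cs : CoxeterSystem M W} {J : Set B}

lemma isRankedOrder_twistedLE : IsRankedOrder (twistedLE cs J) (twistedLength cs J) where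
  refl := twistedLE_refl
  trans := twistedLE.trans
  rank_lt := twistedLE.twistedLength_lt

lemma isLifting_simple_mul (i : B) :
    IsLifting (twistedLE cs J) (twistedLength cs J) (cs.simple i * ·) where
  invol _ := cs.simple_mul_simple_cancel_left i
  rank x := twistedLength_simple_mul x i
  le_self := twistedLE_simple_mul
  lift := fun h hy hx => h.lift hy hx

lemma minRep_of_mem {w : W} (hw : w ∈ parabolic cs J) : minRep cs J w = 1 := by
  simpa using (isMinRep_one (cs := cs) (J := J)).minRep_mul hw

lemma parPart_of_mem {w : W} (hw : w ∈ parabolic cs J) : parPart cs J w = w := by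
  simp [parPart, minRep_of_mem hw]

lemma twistedLength_of_mem {w : W} (hw : w ∈ parabolic cs J) :
    twistedLength cs J w = -cs.length w := by
  simp [twistedLength, parPart_of_mem hw, minRep_of_mem hw]

lemma exists_left_descent_of_mem {v : W} (hv : v ∈ parabolic cs J) (h : v ≠ 1) :
    ∃ j ∈ J, cs.length (cs.simple j * v) < cs.length v := by
  obtain ⟨ω, hω, hJ, rfl⟩ := exists_reduced_of_mem_parabolic hv
  rcases ω with _ | ⟨j, ω⟩
  · simp at h
  · refine ⟨j, hJ j (by simp), ?_⟩
    have h₁ := cs.length_wordProd_le ω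
    rw [hω.eq, cs.wordProd_cons, cs.simple_mul_simple_cancel_left, List.length_cons]
    omega

lemma isThinPair_of_mem {v w : W} (hv : v ∈ parabolic cs J) (hw : w ∈ parabolic cs J)
    (hvw : twistedLE cs J v w) : IsThinPair (twistedLE cs J) (twistedLength cs J) v w := by
  induction hn : cs.length v using Nat.strong_induction_on generalizing v w with
  | _ n ih =>
    by_cases h : v = 1
    · subst h
      have := isRankedOrder_twistedLE.rank_le hvw
      rw [twistedLength_of_mem hw, twistedLength_of_mem hv] at this
      rw [cs.length_one] at this
      have hr : twistedLength cs J w ≤ 0 := by rw [twistedLength_of_mem hw]; omega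
      have hr' : twistedLength cs J (1 : W) = 0 := by rw [twistedLength_of_mem hv]; simp
      exact ⟨fun h => by omega, fun h => by omega⟩
    · obtain ⟨j, hj, hl⟩ := exists_left_descent_of_mem hv h
      have hj' := simple_mem_parabolic (cs := cs) hj
      refine (isLifting_simple_mul j).isThinPair_of_raise isRankedOrder_twistedLE hvw ?_
        fun _ h₂ => ih _ (by omega) (mul_mem hj' hv) (mul_mem hj' hw) h₂ rfl
      rw [twistedLength_of_mem hv, twistedLength_of_mem (mul_mem hj' hv)]
      have := cs.length_simple_mul v j
      omega

/-- Intervals of `≤^J` are thin. -/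
lemma twistedLE.isThinPair {v w : W} (hvw : twistedLE cs J v w) :
    IsThinPair (twistedLE cs J) (twistedLength cs J) v w := by
  induction hn : cs.length (minRep cs J w) using Nat.strong_induction_on generalizing v w with
  | _ n ih =>
    by_cases h : minRep cs J w = 1
    · have hw : w ∈ parabolic cs J := by
        simpa [parPart, h] using parPart_mem (cs := cs) (J := J) w
      have hv : v ∈ parabolic cs J := by
        obtain ⟨u, hu, h₁, -⟩ := hvw
        have h₂ := h₁.length_le
        rw [h, cs.length_one, isMinRep_minRep v u hu] at h₂
        have h₃ : minRep cs J v = 1 := by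
          rw [← cs.length_eq_zero_iff]
          omega
        simpa [parPart, h₃] using parPart_mem (cs := cs) (J := J) v
      exact isThinPair_of_mem hv hw hvw
    · obtain ⟨i, hi⟩ := cs.exists_leftDescent_of_ne_one h
      have hi' : cs.length (cs.simple i * minRep cs J w) < cs.length (minRep cs J w) := hi
      rcases simple_mul_cases (cs := cs) (J := J) w i with ⟨-, h₁, h₂⟩ | ⟨j, hj, hij, -, -⟩
      · refine (isLifting_simple_mul i).isThinPair_of_lower isRankedOrder_twistedLE hvw ?_
          fun _ h₃ => ih _ (by rw [← hn, h₁]; exact hi') h₃ rfl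
        have := cs.length_simple_mul (minRep cs J w) i
        rw [twistedLength, twistedLength, h₁, h₂]
        omega
      · have := length_simple_mul_minRep (isMinRep_minRep w) hj hij
        omega

end TwistedThin

section RankedChains

variable {α : Type*} {cov : α → α → Prop} {r : α → ℤ}

lemma IsChainFrom.length_eq (hcov : ∀ p q, cov p q → r q = r p + 1) {c : List α} {p q : α}
    (hc : IsChainFrom cov c p q) : (c.length : ℤ) = r q - r p + 1 := by
  induction c generalizing p with
  | nil => simp [IsChainFrom] at hc
  | cons a c ih =>
    obtain ⟨h₁, h₂, h₃⟩ := hc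
    obtain rfl : a = p := by simpa using h₁
    rcases c with _ | ⟨b, c⟩
    · obtain rfl : a = q := by simpa using h₂
      simp
    · obtain ⟨h₄, h₅⟩ := List.isChain_cons_cons.1 h₃
      have h₆ := ih (p := b) ⟨rfl, by simpa using h₂, h₅⟩
      have h₇ := hcov a b h₄
      rw [List.length_cons]
      push_cast
      omega

lemma exists_isChainFrom_of_reflTransGen {p q : α} (h : Relation.ReflTransGen cov p q) :
    ∃ c, IsChainFrom cov c p q := by
  induction h using Relation.ReflTransGen.head_induction_on with
  | refl => exact ⟨[q], rfl, rfl, List.isChain_singleton q⟩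
  | @head a b hab _ ih =>
    obtain ⟨c, h₁, h₂, h₃⟩ := ih
    rcases c with _ | ⟨b', c⟩
    · simp at h₁
    · obtain rfl : b' = b := by simpa using h₁
      exact ⟨a :: b' :: c, rfl, by simpa using h₂, List.isChain_cons_cons.2 ⟨hab, h₃⟩⟩

end RankedChains

section RankedIntervals

variable {α : Type*} {le : α → α → Prop} {r : α → ℤ}

lemma IsRankedOrder.interval_ncard (hr : IsRankedOrder le r) {v w : α} (hvw : le v w)
    (ht : IsThinPair le r v w) :
    (r w = r v → {z | le v z ∧ le z w}.ncard = 1) ∧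
    (r w = r v + 1 → {z | le v z ∧ le z w}.ncard = 2) ∧
    (r w = r v + 2 → {z | le v z ∧ le z w}.ncard = 4) := by
  refine ⟨fun h => ?_, fun h => ?_, fun h => ?_⟩
  · obtain rfl := hr.eq_of_rank_le hvw h.le
    rw [Set.ncard_eq_one]
    refine ⟨v, Set.ext fun z => ⟨fun hz => ?_, ?_⟩⟩
    · exact hr.eq_of_rank_le hz.2 (hr.rank_le hz.1)
    · rintro rfl
      exact ⟨hr.refl _, hr.refl _⟩
  · rw [Set.ncard_eq_two]
    refine ⟨v, w, fun he => by rw [he] at h; omega, Set.ext fun z => ⟨fun hz => ?_, ?_⟩⟩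
    · by_cases hv : r z ≤ r v
      · exact .inl (hr.eq_of_rank_le hz.1 hv).symm
      · exact .inr (hr.eq_of_rank_le hz.2 (by omega))
    · rintro (rfl | rfl)
      · exact ⟨hr.refl _, hvw⟩
      · exact ⟨hvw, hr.refl _⟩
  · obtain ⟨a, b, hab, H⟩ := ht.2 h
    obtain ⟨ha₁, ha₂, ha₃⟩ := (H a).2 (.inl rfl)
    obtain ⟨hb₁, hb₂, hb₃⟩ := (H b).2 (.inr rfl)
    have hset : {z | le v z ∧ le z w} = {v, a, b, w} := by
      refine Set.ext fun z => ⟨fun hz => ?_, ?_⟩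
      · by_cases hv : r z ≤ r v
        · exact .inl (hr.eq_of_rank_le hz.1 hv).symm
        by_cases hw : r w ≤ r z
        · exact .inr (.inr (.inr (hr.eq_of_rank_le hz.2 hw)))
        rcases (H z).1 ⟨hz.1, hz.2, by omega⟩ with rfl | rfl <;> simp
      · rintro (rfl | rfl | rfl | rfl)
        exacts [⟨hr.refl _, hvw⟩, ⟨ha₁, ha₂⟩, ⟨hb₁, hb₂⟩, ⟨hvw, hr.refl _⟩]
    have hne : ∀ {x y : α}, r x < r y → x ≠ y := fun hlt he => by simp [he] at hlt
    have h₁ : a ∉ ({b, w} : Set α) := by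
      rintro (h' | h')
      exacts [hab h', hne (by omega) h']
    have h₂ : v ∉ ({a, b, w} : Set α) := by
      rintro (h' | h' | h') <;> exact hne (by omega) h'
    rw [hset, Set.ncard_insert_of_notMem h₂, Set.ncard_insert_of_notMem h₁,
      Set.ncard_pair (hne (by omega))]

end RankedIntervals

section AugmentedIntervals

variable {cs : CoxeterSystem M W} {J : Set B}

/-- The rank function of `Q̂^J`, normalized by `rk [x, x] = 0`. -/
noncomputable def qrank (cs : CoxeterSystem M W) (J : Set B) : Option (W × W) → ℤ
  | none => -1
  | some p => twistedLength cs J p.2 - twistedLength cs J p.1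

lemma qlt.qrank_lt {p q : Option (W × W)} (hq : qvalid cs J q) (h : qlt cs J p q) :
    qrank cs J p < qrank cs J q := by
  have hr := isRankedOrder_twistedLE (cs := cs) (J := J)
  obtain ⟨hle, hne⟩ := h
  rcases p with _ | ⟨x₁, y₁⟩ <;> rcases q with _ | ⟨x₂, y₂⟩
  · exact (hne rfl).elim
  · have : twistedLength cs J x₂ ≤ twistedLength cs J y₂ := hr.rank_le hq
    simp only [qrank]
    omega
  · exact hle.elim
  · obtain ⟨hx, hy⟩ : twistedLE cs J x₂ x₁ ∧ twistedLE cs J y₁ y₂ := hle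
    have h₁ := hr.rank_le hx
    have h₂ := hr.rank_le hy
    simp only [qrank]
    by_contra hlt
    exact hne (by rw [hr.eq_of_rank_le hx (by omega), hr.eq_of_rank_le hy (by omega)])

lemma exists_qlt_qlt {p q : Option (W × W)} (hp : qvalid cs J p) (hq : qvalid cs J q)
    (h : qle cs J p q) (hpq : qrank cs J p + 2 ≤ qrank cs J q) :
    ∃ z, qvalid cs J z ∧ qlt cs J p z ∧ qlt cs J z q := by
  have hr := isRankedOrder_twistedLE (cs := cs) (J := J)
  have hne : ∀ {x y : Option (W × W)}, qrank cs J x < qrank cs J y → x ≠ y :=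
    fun hlt he => by simp [he] at hlt
  rcases p with _ | ⟨x₁, y₁⟩ <;> rcases q with _ | ⟨x₂, y₂⟩
  · omega
  · simp only [qrank] at hpq
    exact ⟨some (x₂, x₂), twistedLE_refl _, ⟨trivial, by simp⟩, ⟨twistedLE_refl _, hq⟩,
      hne (by simp only [qrank]; omega)⟩
  · exact h.elim
  obtain ⟨hx, hy⟩ : twistedLE cs J x₂ x₁ ∧ twistedLE cs J y₁ y₂ := h
  have hp' : twistedLE cs J x₁ y₁ := hp
  have h₁ := hr.rank_le hx
  have h₂ := hr.rank_le hy
  simp only [qrank] at hpq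
  by_cases hyeq : y₁ = y₂
  · subst hyeq
    obtain ⟨z, hz₁, hz₂, hz₃, hz₄⟩ := hx.isThinPair.1 (by omega)
    exact ⟨some (z, y₁), hz₂.trans hp', ⟨⟨hz₂, twistedLE_refl _⟩,
      hne (by simp only [qrank]; omega)⟩,
      ⟨hz₁, twistedLE_refl _⟩, hne (by simp only [qrank]; omega)⟩
  have hylt := hr.rank_lt hy hyeq
  by_cases hxeq : x₂ = x₁
  · subst hxeq
    obtain ⟨z, hz₁, hz₂, hz₃, hz₄⟩ := hy.isThinPair.1 (by omega)
    exact ⟨some (x₂, z), hp'.trans hz₁, ⟨⟨twistedLE_refl _, hz₁⟩,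
      hne (by simp only [qrank]; omega)⟩,
      ⟨twistedLE_refl _, hz₂⟩, hne (by simp only [qrank]; omega)⟩
  have hxlt := hr.rank_lt hx hxeq
  exact ⟨some (x₁, y₂), hp'.trans hy, ⟨⟨twistedLE_refl _, hy⟩, hne (by simp only [qrank]; omega)⟩,
    ⟨hx, twistedLE_refl _⟩, hne (by simp only [qrank]; omega)⟩

lemma qcov.qrank_eq {p q : Option (W × W)} (h : qcov cs J p q) :
    qrank cs J q = qrank cs J p + 1 := by
  obtain ⟨hp, hq, hlt, hmid⟩ := h
  have := hlt.qrank_lt hq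
  by_contra hne
  exact hmid (exists_qlt_qlt hp hq hlt.1 (by omega))

lemma reflTransGen_qcov {p q : Option (W × W)} (hp : qvalid cs J p) (hq : qvalid cs J q)
    (h : qle cs J p q) : Relation.ReflTransGen (qcov cs J) p q := by
  induction hn : (qrank cs J q - qrank cs J p).toNat using Nat.strong_induction_on
    generalizing p q with
  | _ n ih =>
    by_cases hpq : p = q
    · rw [hpq]
    by_cases hmid : ∃ z, qvalid cs J z ∧ qlt cs J p z ∧ qlt cs J z q
    · obtain ⟨z, hz, hpz, hzq⟩ := hmid
      have h₁ := hpz.qrank_lt hz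
      have h₂ := hzq.qrank_lt hq
      exact (ih _ (by omega) hp hz hpz.1 rfl).trans (ih _ (by omega) hz hq hzq.1 rfl)
    · exact .single ⟨hp, hq, ⟨h, hpq⟩, hmid⟩

lemma ncard_qinterval {p q : Option (W × W)} (hp : qvalid cs J p) (hq : qvalid cs J q)
    (h : qle cs J p q) (hpq : qrank cs J q = qrank cs J p + 2) :
    {z | qvalid cs J z ∧ qle cs J p z ∧ qle cs J z q}.ncard = 4 := by
  have hr := isRankedOrder_twistedLE (cs := cs) (J := J)
  rcases p with _ | ⟨x₁, y₁⟩ <;> rcases q with _ | ⟨x, y⟩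
  · omega
  · have hxy : twistedLE cs J x y := hq
    simp only [qrank] at hpq
    have hne : x ≠ y := by
      rintro rfl
      omega
    have hset : {z | qvalid cs J z ∧ qle cs J none z ∧ qle cs J z (some (x, y))} =
        {none, some (x, x), some (y, y), some (x, y)} := by
      refine Set.ext fun z => ⟨?_, ?_⟩
      · rintro ⟨h₁, -, h₂⟩
        rcases z with _ | ⟨a, b⟩
        · exact .inl rfl
        obtain ⟨hxa, hby⟩ : twistedLE cs J x a ∧ twistedLE cs J b y := h₂
        have hab : twistedLE cs J a b := h₁
        have e₁ := hr.rank_le hxa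
        have e₂ := hr.rank_le hab
        have e₃ := hr.rank_le hby
        by_cases ha : twistedLength cs J a ≤ twistedLength cs J x
        · obtain rfl := hr.eq_of_rank_le hxa ha
          by_cases hb : twistedLength cs J y ≤ twistedLength cs J b
          · simp [hr.eq_of_rank_le hby hb]
          · simp [← hr.eq_of_rank_le hab (by omega)]
        · simp [hr.eq_of_rank_le hby (by omega), hr.eq_of_rank_le (hab.trans hby) (by omega)]
      · rintro (rfl | rfl | rfl | rfl)
        exacts [⟨trivial, trivial, trivial⟩, ⟨twistedLE_refl _, trivial, twistedLE_refl _, hxy⟩,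
          ⟨twistedLE_refl _, trivial, hxy, twistedLE_refl _⟩,
          ⟨hxy, trivial, twistedLE_refl _, twistedLE_refl _⟩]
    rw [hset, Set.ncard_insert_of_notMem (by simp), Set.ncard_insert_of_notMem (by simp [hne]),
      Set.ncard_pair (by simp [hne.symm])]
  · exact h.elim
  · obtain ⟨hx, hy⟩ : twistedLE cs J x x₁ ∧ twistedLE cs J y₁ y := h
    have hp' : twistedLE cs J x₁ y₁ := hp
    have hset : {z | qvalid cs J z ∧ qle cs J (some (x₁, y₁)) z ∧ qle cs J z (some (x, y))} =
        some '' ({a | twistedLE cs J x a ∧ twistedLE cs J a x₁} ×ˢ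
          {b | twistedLE cs J y₁ b ∧ twistedLE cs J b y}) := by
      refine Set.ext fun z => ⟨?_, ?_⟩
      · rintro ⟨-, h₁, h₂⟩
        rcases z with _ | ⟨a, b⟩
        · exact h₁.elim
        · exact ⟨(a, b), ⟨⟨h₂.1, h₁.1⟩, h₁.2, h₂.2⟩, rfl⟩
      · rintro ⟨⟨a, b⟩, ⟨⟨h₁, h₂⟩, h₃, h₄⟩, rfl⟩
        exact ⟨h₂.trans (hp'.trans h₃), ⟨h₂, h₃⟩, h₁, h₄⟩
    rw [hset, Set.ncard_image_of_injective _ (Option.some_injective _), Set.ncard_prod]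
    obtain ⟨cx₀, cx₁, cx₂⟩ := hr.interval_ncard hx hx.isThinPair
    obtain ⟨cy₀, cy₁, cy₂⟩ := hr.interval_ncard hy hy.isThinPair
    have e₁ := hr.rank_le hx
    have e₂ := hr.rank_le hy
    simp only [qrank] at hpq
    obtain hd | hd | hd : twistedLength cs J x₁ = twistedLength cs J x ∨
        twistedLength cs J x₁ = twistedLength cs J x + 1 ∨
        twistedLength cs J x₁ = twistedLength cs J x + 2 := by omega
    · rw [cx₀ hd, cy₂ (by omega)]
    · rw [cx₁ hd, cy₁ (by omega)]
    · rw [cx₂ hd, cy₀ (by omega)]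

end AugmentedIntervals

/-- Let `J ⊆ I`. Every interval of the augmented interval poset
`Q̂^J` is graded and thin: for any `q₁ ≤ q₂` in `Q̂^J`, a maximal chain from `q₁`
to `q₂` exists, all maximal chains from `q₁` to `q₂` have the same length, and
every interval of length `2` (i.e. one carrying a maximal chain with `3`
elements) contains exactly `4` elements. -/
theorem qhat_graded_thin (J : Set B) (q₁ q₂ : Option (W × W))
    (h₁ : qvalid cs J q₁) (h₂ : qvalid cs J q₂) (h₁₂ : qle cs J q₁ q₂) :
    (∃ c : List (Option (W × W)), IsChainFrom (qcov cs J) c q₁ q₂) ∧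
    (∀ c c' : List (Option (W × W)), IsChainFrom (qcov cs J) c q₁ q₂ →
      IsChainFrom (qcov cs J) c' q₁ q₂ → c.length = c'.length) ∧
    (∀ c : List (Option (W × W)), IsChainFrom (qcov cs J) c q₁ q₂ → c.length = 3 →
      {z : Option (W × W) | qvalid cs J z ∧ qle cs J q₁ z ∧ qle cs J z q₂}.ncard = 4) := by
  refine ⟨exists_isChainFrom_of_reflTransGen (reflTransGen_qcov h₁ h₂ h₁₂), fun c c' hc hc' => ?_,
    fun c hc hlen => ncard_qinterval h₁ h₂ h₁₂ ?_⟩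
  · have e₁ := hc.length_eq fun _ _ h => h.qrank_eq
    have e₂ := hc'.length_eq fun _ _ h => h.qrank_eq
    omega
  · have e₁ := hc.length_eq fun _ _ h => h.qrank_eq
    omega

end TwistedTP
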